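/- Second-order converse for information reconciliation: let P_{XY} be a joint distribution on finite sets with V(X|Y)_P > 0 and 0 < ε < 1. There is a constant C (depending only on P_{XY} and ε) such that for all sufficiently large n, any ε-correct one-way IR code on (P_{XY})^{×n} satisfies log|M| ≥ n H(X|Y)_P + √(n V(X|Y)_P) · Φ^{-1}(1-ε) - (1/2) log n - C. -/

import Mathlib

open scoped BigOperators
noncomputable section

/-- Conditional entropy `H(X|Y)_P`. -/
def condH {X Y : Type*} [Fintype X] [Fintype Y] (P : X → Y → ℝ) : ℝ :=
  ∑ x, ∑ y, P x y * Real.log ((∑ x', P x' y) / P x y)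

/-- Conditional entropy variance `V(X|Y)_P`. -/
def condV {X Y : Type*} [Fintype X] [Fintype Y] (P : X → Y → ℝ) : ℝ :=
  ∑ x, ∑ y, P x y * (Real.log ((∑ x', P x' y) / P x y) - condH P)^2

/-- Standard normal cumulative distribution function. -/
def NPhi (x : ℝ) : ℝ := ∫ u in Set.Iic x, Real.exp (-u^2/2) / Real.sqrt (2*Real.pi)

/-- Inverse of the standard normal CDF. -/
def NPhiInv : ℝ → ℝ := Function.invFun NPhi

section SecondOrder

open MeasureTheory Filter Topology

/-- Standard normal density. -/
def stdDens (u : ℝ) : ℝ := Real.exp (-u ^ 2 / 2) / Real.sqrt (2 * Real.pi)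

lemma stdDens_pos (u : ℝ) : 0 < stdDens u := by
  unfold stdDens; positivity

lemma stdDens_eq_gaussianPDFReal : stdDens = ProbabilityTheory.gaussianPDFReal 0 1 := by
  funext u
  simp [stdDens, ProbabilityTheory.gaussianPDFReal_def, div_eq_inv_mul]

lemma integrable_stdDens : Integrable stdDens := by
  rw [stdDens_eq_gaussianPDFReal]
  exact ProbabilityTheory.integrable_gaussianPDFReal 0 1

lemma integral_stdDens : ∫ u, stdDens u = 1 := by
  rw [stdDens_eq_gaussianPDFReal]
  exact ProbabilityTheory.integral_gaussianPDFReal_eq_one 0 one_ne_zero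

lemma continuous_stdDens : Continuous stdDens := by
  unfold stdDens; fun_prop

lemma hasDerivAt_stdDens (u : ℝ) : HasDerivAt stdDens (-u * stdDens u) u := by
  have h1 : HasDerivAt (fun u : ℝ => -u ^ 2 / 2) (-u) u := by
    have := ((hasDerivAt_pow 2 u).neg).div_const 2
    refine this.congr_deriv ?_
    norm_num
    ring
  have h2 := (h1.exp).div_const (Real.sqrt (2 * Real.pi))
  refine h2.congr_deriv ?_
  unfold stdDens
  ring

lemma integrable_mul_stdDens : Integrable (fun u => u * stdDens u) := by
  have h := (integrable_mul_exp_neg_mul_sq (b := 1 / 2) (by norm_num)).div_const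
    (Real.sqrt (2 * Real.pi))
  refine h.congr (ae_of_all _ fun u => ?_)
  simp only [stdDens]
  rw [mul_div_assoc]
  congr 3
  ring

lemma stdDens_anti {u v : ℝ} (h : |u| ≤ |v|) : stdDens v ≤ stdDens u := by
  unfold stdDens
  have := sq_le_sq.2 h
  gcongr

lemma tendsto_stdDens_atTop : Tendsto stdDens atTop (𝓝 0) := by
  unfold stdDens
  rw [← zero_div (Real.sqrt (2 * Real.pi))]
  refine Tendsto.div_const (Real.tendsto_exp_atBot.comp ?_) _
  have h : Tendsto (fun u : ℝ => u ^ 2 / 2) atTop atTop :=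
    (tendsto_pow_atTop (by norm_num)).atTop_div_const (by norm_num)
  have h' := tendsto_neg_atTop_atBot.comp h
  refine h'.congr fun u => ?_
  simp only [Function.comp]
  ring

lemma tendsto_stdDens_atBot : Tendsto stdDens atBot (𝓝 0) := by
  have h := tendsto_stdDens_atTop.comp tendsto_neg_atBot_atTop
  refine h.congr fun u => ?_
  simp [stdDens]

lemma NPhi_eq (x : ℝ) : NPhi x = ∫ u in Set.Iic x, stdDens u := rfl

lemma tendsto_NPhi_atTop : Tendsto NPhi atTop (𝓝 1) := by
  rw [← integral_stdDens]
  exact (aecover_Iic tendsto_id).integral_tendsto_of_countably_generated integrable_stdDens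

lemma NPhi_add_Ioi (x : ℝ) : NPhi x + ∫ u in Set.Ioi x, stdDens u = 1 := by
  have h := integral_add_compl (measurableSet_Iic (a := x)) integrable_stdDens
  rwa [Set.compl_Iic, integral_stdDens] at h

lemma tendsto_NPhi_atBot : Tendsto NPhi atBot (𝓝 0) := by
  have h := (aecover_Ioi (μ := volume) (l := atBot)
    (tendsto_id (α := ℝ))).integral_tendsto_of_countably_generated
    integrable_stdDens
  rw [integral_stdDens] at h
  have h2 := h.const_sub 1
  rw [sub_self] at h2
  refine h2.congr fun x => ?_
  have := NPhi_add_Ioi x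
  simp only [id]
  linarith

lemma hasDerivAt_integral_Iic {g : ℝ → ℝ} (hc : Continuous g) (hi : Integrable g) (x : ℝ) :
    HasDerivAt (fun w => ∫ u in Set.Iic w, g u) (g x) x := by
  have h : (fun w => ∫ u in Set.Iic w, g u)
      = fun w => (∫ u in Set.Iic (0 : ℝ), g u) + ∫ u in (0 : ℝ)..w, g u := by
    funext w
    rw [← intervalIntegral.integral_Iic_sub_Iic hi.integrableOn hi.integrableOn]
    ring
  rw [h]
  exact (intervalIntegral.integral_hasDerivAt_right (hc.intervalIntegrable _ _)
    (hc.stronglyMeasurableAtFilter _ _) hc.continuousAt).const_add _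

lemma hasDerivAt_NPhi (x : ℝ) : HasDerivAt NPhi (stdDens x) x :=
  hasDerivAt_integral_Iic continuous_stdDens integrable_stdDens x

lemma NPhi_NPhiInv {p : ℝ} (h0 : 0 < p) (h1 : p < 1) : NPhi (NPhiInv p) = p := by
  refine Function.invFun_eq ?_
  have hc : Continuous NPhi :=
    continuous_iff_continuousAt.2 fun x => (hasDerivAt_NPhi x).continuousAt
  obtain ⟨a, ha⟩ := (tendsto_NPhi_atBot.eventually (gt_mem_nhds h0)).exists
  obtain ⟨b, hb⟩ := (tendsto_NPhi_atTop.eventually (lt_mem_nhds h1)).exists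
  obtain ⟨x, -, hx⟩ := intermediate_value_uIcc (a := a) (b := b) hc.continuousOn
    (Set.mem_uIcc.2 (Or.inl ⟨ha.le, hb.le⟩))
  exact ⟨x, hx⟩

/-- A linear lower bound for the decrease of the normal CDF just left of `t`. -/
lemma NPhi_sub_le (t : ℝ) : ∃ c > 0, ∀ s, 0 ≤ s → s ≤ 1 → NPhi (t - s) ≤ NPhi t - c * s := by
  refine ⟨stdDens (|t| + 1), stdDens_pos _, fun s hs0 hs1 => ?_⟩
  rcases hs0.eq_or_lt with rfl | hs
  · simp
  obtain ⟨c, hc, hc'⟩ := exists_hasDerivAt_eq_slope NPhi stdDens (a := t - s) (b := t)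
    (by linarith) (fun x _ => (hasDerivAt_NPhi x).continuousAt.continuousWithinAt)
    (fun x _ => hasDerivAt_NPhi x)
  have hle : stdDens (|t| + 1) ≤ stdDens c := by
    refine stdDens_anti ?_
    rw [abs_of_nonneg (by positivity : 0 ≤ |t| + 1)]
    have := abs_le.1 (le_refl |t|)
    rw [abs_le]
    constructor <;> linarith [hc.1, hc.2]
  have : t - (t - s) = s := by ring
  rw [this, eq_div_iff hs.ne'] at hc'
  nlinarith

lemma mills_Iic (w : ℝ) : -w * ∫ u in Set.Iic w, stdDens u ≤ stdDens w := by
  have h : ∫ u in Set.Iic w, -u * stdDens u = stdDens w - 0 :=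
    integral_Iic_of_hasDerivAt_of_tendsto' (fun x _ => hasDerivAt_stdDens x)
      (by simpa using integrable_mul_stdDens.neg.integrableOn) tendsto_stdDens_atBot
  rw [← integral_const_mul, ← sub_zero (stdDens w), ← h]
  refine setIntegral_mono_on (integrable_stdDens.const_mul _).integrableOn
    (by simpa using integrable_mul_stdDens.neg.integrableOn) measurableSet_Iic fun u hu => ?_
  have : u ≤ w := hu
  have := stdDens_pos u
  nlinarith

lemma mills_Ioi (w : ℝ) : w * ∫ u in Set.Ioi w, stdDens u ≤ stdDens w := by
  have h : ∫ u in Set.Ioi w, -u * stdDens u = 0 - stdDens w :=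
    integral_Ioi_of_hasDerivAt_of_tendsto' (fun x _ => hasDerivAt_stdDens x)
      (by simpa using integrable_mul_stdDens.neg.integrableOn) tendsto_stdDens_atTop
  have h2 : ∫ u in Set.Ioi w, u * stdDens u = stdDens w := by
    have := integral_neg (μ := volume.restrict (Set.Ioi w)) (fun u => u * stdDens u)
    simp only [neg_mul] at h
    linarith
  rw [← integral_const_mul, ← h2]
  refine setIntegral_mono_on (integrable_stdDens.const_mul _).integrableOn
    integrable_mul_stdDens.integrableOn measurableSet_Ioi fun u hu => ?_
  have : w < u := hu
  have := stdDens_pos u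
  nlinarith

/-- Bounded solutions of the Stein equation for a continuous test function with values in `[0,1]`,
with bounds not depending on the test function. -/
lemma stein_equation : ∃ K > 0, ∀ h : ℝ → ℝ, Continuous h → (∀ u, 0 ≤ h u) → (∀ u, h u ≤ 1) →
    ∃ f : ℝ → ℝ, (∀ w, |f w| ≤ K) ∧ (∀ w, |w * f w| ≤ 1) ∧
      ∀ w, HasDerivAt f (w * f w + h w - ∫ u, h u * stdDens u) w := by
  refine ⟨1 / stdDens 1 + 1, by have := stdDens_pos 1; positivity, fun h hc h0 h1 => ?_⟩
  have hhi : Integrable (fun u => h u * stdDens u) := by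
    refine integrable_stdDens.mono' (hc.mul continuous_stdDens).aestronglyMeasurable
      (ae_of_all _ fun u => ?_)
    have := stdDens_pos u
    rw [Real.norm_eq_abs, abs_of_nonneg (mul_nonneg (h0 u) this.le)]
    nlinarith [h1 u]
  set N := ∫ u, h u * stdDens u with hN
  have hN0 : 0 ≤ N := integral_nonneg fun u => mul_nonneg (h0 u) (stdDens_pos u).le
  have hN1 : N ≤ 1 := by
    rw [← integral_stdDens]
    refine integral_mono hhi integrable_stdDens fun u => ?_
    have := stdDens_pos u
    dsimp only
    nlinarith [h1 u]
  set g : ℝ → ℝ := fun u => (h u - N) * stdDens u with hg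
  have hgc : Continuous g := (hc.sub continuous_const).mul continuous_stdDens
  have hgb : ∀ u, |g u| ≤ stdDens u := fun u => by
    have := stdDens_pos u
    rw [hg]
    simp only
    rw [abs_mul, abs_of_pos this]
    have : |h u - N| ≤ 1 := abs_le.2 ⟨by linarith [h0 u], by linarith [h1 u]⟩
    nlinarith
  have hgi : Integrable g :=
    integrable_stdDens.mono' hgc.aestronglyMeasurable (ae_of_all _ hgb)
  have hg0 : ∫ u, g u = 0 := by
    have : g = fun u => h u * stdDens u - N * stdDens u := by funext u; simp only [hg]; ring
    rw [this, integral_sub hhi (integrable_stdDens.const_mul _), integral_const_mul,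
      integral_stdDens, ← hN]
    ring
  set G : ℝ → ℝ := fun w => ∫ u in Set.Iic w, g u with hG
  have hG1 : ∀ w, |G w| ≤ ∫ u in Set.Iic w, stdDens u := fun w =>
    norm_integral_le_of_norm_le (f := g) integrable_stdDens.integrableOn (ae_of_all _ hgb)
  have hG2 : ∀ w, |G w| ≤ ∫ u in Set.Ioi w, stdDens u := fun w => by
    have h := integral_add_compl (measurableSet_Iic (a := w)) hgi
    rw [hg0, Set.compl_Iic] at h
    have : G w = -∫ u in Set.Ioi w, g u := by simp only [hG]; linarith
    rw [this, abs_neg]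
    exact norm_integral_le_of_norm_le (f := g) integrable_stdDens.integrableOn (ae_of_all _ hgb)
  have hwf : ∀ w, |w * (G w / stdDens w)| ≤ 1 := fun w => by
    have hp := stdDens_pos w
    rw [abs_mul, abs_div, abs_of_pos hp, ← mul_div_assoc, div_le_one hp]
    rcases lt_trichotomy w 0 with hw | rfl | hw
    · rw [abs_of_neg hw]
      exact (mul_le_mul_of_nonneg_left (hG1 w) (by linarith)).trans (mills_Iic w)
    · simp [hp.le]
    · rw [abs_of_pos hw]
      exact (mul_le_mul_of_nonneg_left (hG2 w) hw.le).trans (mills_Ioi w)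
  refine ⟨fun w => G w / stdDens w, fun w => ?_, hwf, fun w => ?_⟩
  · have hp := stdDens_pos w
    have hp1 := stdDens_pos 1
    rcases le_total |w| 1 with hw | hw
    · have hG3 : |G w| ≤ 1 := by
        refine (hG1 w).trans ?_
        rw [← integral_stdDens]
        exact setIntegral_le_integral integrable_stdDens
          (ae_of_all _ fun u => (stdDens_pos u).le)
      have : |G w / stdDens w| ≤ 1 / stdDens 1 := by
        rw [abs_div, abs_of_pos hp]
        exact div_le_div₀ zero_le_one hG3 hp1 (stdDens_anti (by simpa using hw))
      linarith
    · have h := hwf w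
      rw [abs_mul] at h
      have h2 : |G w / stdDens w| ≤ 1 := by nlinarith [abs_nonneg (G w / stdDens w)]
      have : 0 < 1 / stdDens 1 := by positivity
      linarith
  · have hp := stdDens_pos w
    have hd := (hasDerivAt_integral_Iic hgc hgi w).div (hasDerivAt_stdDens w) hp.ne'
    refine hd.congr_deriv ?_
    change _ = w * (G w / stdDens w) + h w - N
    simp only [hg]
    change ((h w - N) * stdDens w * stdDens w - G w * (-w * stdDens w)) / stdDens w ^ 2 = _
    field_simp
    ring

section IID

lemma sum_sub_coord_update {A : Type*} (ξ : A → ℝ) {n : ℕ} (j : Fin n) (ω : Fin n → A) (a : A) :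
    ∑ i, ξ (Function.update ω j a i) - ξ (Function.update ω j a j)
      = ∑ i, ξ (ω i) - ξ (ω j) := by
  rw [← Finset.sum_erase_eq_sub (Finset.mem_univ j), ← Finset.sum_erase_eq_sub (Finset.mem_univ j)]
  refine Finset.sum_congr rfl fun i hi => ?_
  rw [Function.update_of_ne (Finset.ne_of_mem_erase hi)]

variable {A : Type*} [Fintype A]

/-- Expectation over `n` independent samples drawn from the weights `p`. -/
def iidExp (p : A → ℝ) {n : ℕ} (g : (Fin n → A) → ℝ) : ℝ :=
  ∑ ω, (∏ i, p (ω i)) * g ω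

lemma iidExp_add (p : A → ℝ) {n : ℕ} (g h : (Fin n → A) → ℝ) :
    iidExp p (fun ω => g ω + h ω) = iidExp p g + iidExp p h := by
  simp [iidExp, mul_add, Finset.sum_add_distrib]

lemma iidExp_sub (p : A → ℝ) {n : ℕ} (g h : (Fin n → A) → ℝ) :
    iidExp p (fun ω => g ω - h ω) = iidExp p g - iidExp p h := by
  simp [iidExp, mul_sub, Finset.sum_sub_distrib]

lemma iidExp_const_mul (p : A → ℝ) {n : ℕ} (c : ℝ) (g : (Fin n → A) → ℝ) :
    iidExp p (fun ω => c * g ω) = c * iidExp p g := by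
  simp [iidExp, Finset.mul_sum, mul_left_comm]

lemma iidExp_sum (p : A → ℝ) {n : ℕ} {ι : Type*} (s : Finset ι) (g : ι → (Fin n → A) → ℝ) :
    iidExp p (fun ω => ∑ j ∈ s, g j ω) = ∑ j ∈ s, iidExp p (g j) := by
  simp only [iidExp, Finset.mul_sum]
  exact Finset.sum_comm

lemma iidExp_mono {p : A → ℝ} (hp : ∀ a, 0 ≤ p a) {n : ℕ} {g h : (Fin n → A) → ℝ}
    (hgh : ∀ ω, g ω ≤ h ω) : iidExp p g ≤ iidExp p h :=
  Finset.sum_le_sum fun ω _ =>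
    mul_le_mul_of_nonneg_left (hgh ω) (Finset.prod_nonneg fun _ _ => hp _)

lemma iidExp_const {p : A → ℝ} (hp1 : ∑ a, p a = 1) {n : ℕ} (c : ℝ) :
    iidExp p (fun _ : Fin n → A => c) = c := by
  rw [iidExp, ← Finset.sum_mul, ← Fintype.sum_pow, hp1, one_pow, one_mul]

/-- A centred coordinate is uncorrelated with any function of the other coordinates. -/
lemma iidExp_coord_mul {p ξ : A → ℝ} (hξ : ∑ a, p a * ξ a = 0) {n : ℕ} (j : Fin n)
    {g : (Fin n → A) → ℝ} (hg : ∀ ω a, g (Function.update ω j a) = g ω) :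
    iidExp p (fun ω => ξ (ω j) * g ω) = 0 := by
  obtain _ | n := n
  · exact j.elim0
  rcases isEmpty_or_nonempty A with hA | ⟨⟨b⟩⟩
  · simp [iidExp]
  rw [iidExp, ← (Fin.insertNthEquiv (fun _ => A) j).sum_comp, Fintype.sum_prod_type,
    Finset.sum_comm]
  refine Finset.sum_eq_zero fun ω _ => ?_
  have key : ∀ a, g (j.insertNth a ω) = g (j.insertNth b ω) := fun a => by
    rw [← hg (j.insertNth b ω) a, Fin.update_insertNth]
  have : ∀ a, (∏ i, p (Fin.insertNthEquiv (fun _ => A) j (a, ω) i))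
      * (ξ (Fin.insertNthEquiv (fun _ => A) j (a, ω) j)
        * g (Fin.insertNthEquiv (fun _ => A) j (a, ω)))
      = (p a * ξ a) * ((∏ i, p (ω i)) * g (j.insertNth b ω)) := fun a => by
    rw [Fin.prod_univ_succAbove _ j]
    simp only [Fin.insertNthEquiv_apply, Fin.insertNth_apply_same,
      Fin.insertNth_apply_succAbove]
    rw [show g (Fin.insertNthEquiv (fun _ => A) j (a, ω)) = _ from key a]
    ring
  rw [Finset.sum_congr rfl fun a _ => this a, ← Finset.sum_mul, hξ, zero_mul]

/-- Discrete integration by parts for a sum of centred i.i.d. variables. -/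
lemma iidExp_sum_mul {p ξ : A → ℝ} (hξ : ∑ a, p a * ξ a = 0) {n : ℕ} (f : ℝ → ℝ) :
    iidExp p (fun ω : Fin n → A => (∑ j, ξ (ω j)) * f (∑ i, ξ (ω i)))
      = iidExp p (fun ω : Fin n → A => ∑ j, ξ (ω j) * (f (∑ i, ξ (ω i)) - f (∑ i, ξ (ω i) - ξ (ω j)))) := by
  simp only [mul_sub, Finset.sum_sub_distrib, Finset.sum_mul]
  rw [iidExp_sub, iidExp_sum p _ (fun j (ω : Fin n → A) => ξ (ω j) * f (∑ i, ξ (ω i) - ξ (ω j)))]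
  rw [Finset.sum_eq_zero (f := fun j => iidExp p fun ω : Fin n → A =>
    ξ (ω j) * f (∑ i, ξ (ω i) - ξ (ω j))), sub_zero]
  intro j _
  refine iidExp_coord_mul hξ j (g := fun ω => f (∑ i, ξ (ω i) - ξ (ω j))) fun ω a => ?_
  simp only [sum_sub_coord_update]

lemma iidExp_coord {p : A → ℝ} (hp1 : ∑ a, p a = 1) (η : A → ℝ) {n : ℕ} (j : Fin n) :
    iidExp p (fun ω => η (ω j)) = ∑ a, p a * η a := by
  have h : ∑ a, p a * (η a - ∑ b, p b * η b) = 0 := by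
    simp only [mul_sub, Finset.sum_sub_distrib, ← Finset.sum_mul, hp1, one_mul, sub_self]
  have h2 := iidExp_coord_mul h j (g := fun _ => 1) fun _ _ => rfl
  simp only [mul_one] at h2
  rw [iidExp_sub p (fun ω => η (ω j)) (fun _ => ∑ b, p b * η b), iidExp_const hp1] at h2
  linarith

lemma iidExp_sum_sq {p ξ : A → ℝ} (hp1 : ∑ a, p a = 1) (hξ : ∑ a, p a * ξ a = 0) (n : ℕ) :
    iidExp p (fun ω : Fin n → A => (∑ j, ξ (ω j)) ^ 2) = n * ∑ a, p a * ξ a ^ 2 := by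
  have h := iidExp_sum_mul hξ (n := n) id
  simp only [id, sub_sub_cancel, ← sq] at h
  rw [h, iidExp_sum p _ (fun j (ω : Fin n → A) => ξ (ω j) ^ 2)]
  rw [Finset.sum_congr rfl fun j _ => iidExp_coord hp1 (fun a => ξ a ^ 2) j]
  simp

lemma iidExp_abs_le {p : A → ℝ} (hp : ∀ a, 0 ≤ p a) (hp1 : ∑ a, p a = 1) {n : ℕ}
    {g : (Fin n → A) → ℝ} {s : ℝ} (hs : 0 < s) (hg : iidExp p (fun ω => g ω ^ 2) ≤ s ^ 2) :
    iidExp p (fun ω => |g ω|) ≤ s := by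
  have h : iidExp p (fun ω => |g ω|) ≤ iidExp p (fun ω => 1 / (2 * s) * g ω ^ 2 + s / 2) := by
    refine iidExp_mono hp fun ω => ?_
    have : 1 / (2 * s) * g ω ^ 2 + s / 2 - |g ω| = (|g ω| - s) ^ 2 / (2 * s) := by
      rw [← sq_abs (g ω)]
      field_simp
      ring
    have h2 : 0 ≤ (|g ω| - s) ^ 2 / (2 * s) := by positivity
    linarith
  rw [iidExp_add, iidExp_const_mul, iidExp_const hp1] at h
  refine h.trans ?_
  calc 1 / (2 * s) * iidExp p (fun ω => g ω ^ 2) + s / 2 ≤ 1 / (2 * s) * s ^ 2 + s / 2 := by gcongr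
    _ = s := by field_simp; ring

/-- A normalised sum of centred i.i.d. variables bounded by `δ`. -/
structure IsStandardised (p ξ : A → ℝ) (n : ℕ) (δ : ℝ) : Prop where
  nonneg : ∀ a, 0 ≤ p a
  sum_eq_one : ∑ a, p a = 1
  mean : ∑ a, p a * ξ a = 0
  var : n * ∑ a, p a * ξ a ^ 2 = 1
  pos : 0 < δ
  bound : ∀ a, |ξ a| ≤ δ

variable {p ξ : A → ℝ} {n : ℕ} {δ : ℝ}

lemma IsStandardised.iidExp_abs_sum_le (H : IsStandardised p ξ n δ) :
    iidExp p (fun ω : Fin n → A => |∑ i, ξ (ω i)|) ≤ 1 := by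
  refine iidExp_abs_le H.nonneg H.sum_eq_one one_pos ?_
  rw [iidExp_sum_sq H.sum_eq_one H.mean, H.var, one_pow]

lemma IsStandardised.iidExp_abs_sum_sq_sub_one_le (H : IsStandardised p ξ n δ) :
    iidExp p (fun ω : Fin n → A => |∑ i, ξ (ω i) ^ 2 - 1|) ≤ δ := by
  refine iidExp_abs_le H.nonneg H.sum_eq_one H.pos ?_
  set m := ∑ a, p a * ξ a ^ 2 with hm
  have hvar : n * m = 1 := H.var
  have hmean : ∑ a, p a * (ξ a ^ 2 - m) = 0 := by
    simp only [mul_sub, Finset.sum_sub_distrib, ← Finset.sum_mul, H.sum_eq_one, one_mul, ← hm,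
      sub_self]
  have h := iidExp_sum_sq H.sum_eq_one hmean n
  have h1 : ∀ ω : Fin n → A, ∑ i, (ξ (ω i) ^ 2 - m) = ∑ i, ξ (ω i) ^ 2 - 1 := fun ω => by
    rw [Finset.sum_sub_distrib]
    simp [hvar]
  simp only [h1] at h
  rw [h]
  have h2 : ∑ a, p a * (ξ a ^ 2 - m) ^ 2 ≤ δ ^ 2 * m := by
    have h3 : ∑ a, p a * (ξ a ^ 2 - m) ^ 2 = ∑ a, p a * (ξ a ^ 2) ^ 2 - m ^ 2 := by
      have : ∀ a, p a * (ξ a ^ 2 - m) ^ 2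
          = p a * (ξ a ^ 2) ^ 2 - 2 * m * (p a * ξ a ^ 2) + p a * m ^ 2 := fun a => by ring
      simp only [this, Finset.sum_add_distrib, Finset.sum_sub_distrib, ← Finset.mul_sum,
        ← Finset.sum_mul, H.sum_eq_one, ← hm]
      ring
    have h4 : ∑ a, p a * (ξ a ^ 2) ^ 2 ≤ δ ^ 2 * m := by
      rw [hm, Finset.mul_sum]
      refine Finset.sum_le_sum fun a _ => ?_
      have h5 : ξ a ^ 2 ≤ δ ^ 2 := by
        rw [← sq_abs]
        have := H.bound a
        gcongr
      calc p a * (ξ a ^ 2) ^ 2 = (p a * ξ a ^ 2) * ξ a ^ 2 := by ring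
        _ ≤ (p a * ξ a ^ 2) * δ ^ 2 :=
          mul_le_mul_of_nonneg_left h5 (mul_nonneg (H.nonneg a) (sq_nonneg _))
        _ = _ := by ring
    nlinarith [sq_nonneg m]
  calc n * ∑ a, p a * (ξ a ^ 2 - m) ^ 2 ≤ n * (δ ^ 2 * m) := by gcongr
    _ = δ ^ 2 := by linear_combination δ ^ 2 * hvar

/-- Concentration inequality: the sum lies in a short interval with small probability. -/
lemma IsStandardised.iidExp_mem_Icc_le (H : IsStandardised p ξ n δ) {a b : ℝ} (hab : a ≤ b) :
    iidExp p (fun ω : Fin n → A => (Set.Icc a b).indicator 1 (∑ i, ξ (ω i)))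
      ≤ (b - a) / 2 + 2 * δ := by
  set c := (a + b) / 2 with hc
  set r := (b - a) / 2 + δ with hr
  have hδ := H.pos
  have hr0 : 0 < r := by simp only [hr]; linarith
  set f : ℝ → ℝ := fun w => max (-r) (min r (w - c)) with hf
  have hfmono : Monotone f := fun u v huv => by simp only [hf]; gcongr
  have hfb : ∀ w, |f w| ≤ r := fun w =>
    abs_le.2 ⟨le_max_left _ _, max_le (by linarith) (min_le_left _ _)⟩
  have hfin : ∀ w, a - δ ≤ w → w ≤ b + δ → f w = w - c := fun w h1 h2 => by
    simp only [hf]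
    rw [min_eq_right (by linarith), max_eq_right (by linarith)]
  have h1 : iidExp p (fun ω : Fin n → A => (∑ j, ξ (ω j)) * f (∑ i, ξ (ω i))) ≤ r := by
    calc _ ≤ iidExp p (fun ω : Fin n → A => r * |∑ j, ξ (ω j)|) := by
          refine iidExp_mono H.nonneg fun ω => ?_
          refine (le_abs_self _).trans ?_
          rw [abs_mul, mul_comm]
          exact mul_le_mul_of_nonneg_right (hfb _) (abs_nonneg _)
      _ ≤ r := by
        rw [iidExp_const_mul]
        nlinarith [H.iidExp_abs_sum_le]
  rw [iidExp_sum_mul H.mean] at h1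
  have h2 : iidExp p (fun ω : Fin n → A => (Set.Icc a b).indicator 1 (∑ i, ξ (ω i)))
      ≤ iidExp p (fun ω : Fin n → A =>
        ∑ j, ξ (ω j) * (f (∑ i, ξ (ω i)) - f (∑ i, ξ (ω i) - ξ (ω j)))
          + |∑ i, ξ (ω i) ^ 2 - 1|) := by
    refine iidExp_mono H.nonneg fun ω => ?_
    set W := ∑ i, ξ (ω i) with hW
    by_cases hmem : W ∈ Set.Icc a b
    · have : ∀ j, ξ (ω j) * (f W - f (W - ξ (ω j))) = ξ (ω j) ^ 2 := fun j => by
        have hb := abs_le.1 (H.bound (ω j))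
        rw [hfin W (by linarith [hmem.1]) (by linarith [hmem.2]),
          hfin (W - ξ (ω j)) (by linarith [hmem.1]) (by linarith [hmem.2])]
        ring
      rw [Set.indicator_of_mem hmem, Finset.sum_congr rfl fun j _ => this j]
      simp only [Pi.one_apply]
      linarith [neg_abs_le (∑ i, ξ (ω i) ^ 2 - 1)]
    · rw [Set.indicator_of_notMem hmem]
      refine add_nonneg (Finset.sum_nonneg fun j _ => ?_) (abs_nonneg _)
      rcases le_total 0 (ξ (ω j)) with h | h
      · exact mul_nonneg h (sub_nonneg.2 (hfmono (by linarith)))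
      · exact mul_nonneg_of_nonpos_of_nonpos h (sub_nonpos.2 (hfmono (by linarith)))
  rw [iidExp_add] at h2
  linarith [H.iidExp_abs_sum_sq_sub_one_le]

/-- One-sided Berry–Esseen bound for sums of bounded i.i.d. variables. -/
lemma exists_berry_esseen : ∃ K > 0, ∀ (p ξ : A → ℝ) (n : ℕ) (δ D : ℝ), IsStandardised p ξ n δ →
    n * δ ^ 2 ≤ D → ∀ z,
    iidExp p (fun ω : Fin n → A => (Set.Iic z).indicator 1 (∑ i, ξ (ω i)))
      ≤ NPhi (z + δ) + (D * K + 2) * δ := by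
  obtain ⟨K, hK, hstein⟩ := stein_equation
  refine ⟨K + 6, by linarith, fun p ξ n δ D H hD z => ?_⟩
  have hδ := H.pos
  set h : ℝ → ℝ := fun w => max 0 (min 1 ((z + δ - w) / δ)) with hh
  have hh0 : ∀ w, 0 ≤ h w := fun w => le_max_left _ _
  have hh1 : ∀ w, h w ≤ 1 := fun w => max_le zero_le_one (min_le_left _ _)
  have hhc : Continuous h := by simp only [hh]; fun_prop
  have hhl : ∀ w, w ≤ z → h w = 1 := fun w hw => by
    have : 1 ≤ (z + δ - w) / δ := by rw [le_div_iff₀ hδ]; linarith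
    simp only [hh]
    rw [min_eq_left this, max_eq_right zero_le_one]
  have hhr : ∀ w, z + δ ≤ w → h w = 0 := fun w hw => by
    have : (z + δ - w) / δ ≤ 0 := div_nonpos_of_nonpos_of_nonneg (by linarith) hδ.le
    simp only [hh]
    exact max_eq_left ((min_le_right _ _).trans this)
  obtain ⟨f, hfK, hwf, hfd⟩ := hstein h hhc hh0 hh1
  have hN : ∫ u, h u * stdDens u ≤ NPhi (z + δ) := by
    rw [NPhi_eq, ← integral_indicator measurableSet_Iic]
    refine integral_mono_of_nonneg (ae_of_all _ fun u => mul_nonneg (hh0 u) (stdDens_pos u).le)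
      (integrable_stdDens.indicator measurableSet_Iic) (ae_of_all _ fun u => ?_)
    have hp := stdDens_pos u
    by_cases hu : u ≤ z + δ
    · rw [Set.indicator_of_mem (Set.mem_Iic.2 hu)]
      dsimp only
      nlinarith [hh1 u]
    · rw [Set.indicator_of_notMem (by simpa using hu)]
      dsimp only
      rw [hhr u (le_of_not_ge hu), zero_mul]
  have hN0 : 0 ≤ ∫ u, h u * stdDens u :=
    integral_nonneg fun u => mul_nonneg (hh0 u) (stdDens_pos u).le
  have hN1 : ∫ u, h u * stdDens u ≤ 1 := by
    refine hN.trans ?_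
    rw [← NPhi_add_Ioi (z + δ)]
    exact le_add_of_nonneg_right (integral_nonneg fun u => (stdDens_pos u).le)
  set N := ∫ u, h u * stdDens u
  set f' : ℝ → ℝ := fun w => w * f w + h w - N with hf'
  have hf'2 : ∀ w, |f' w| ≤ 2 := fun w => by
    have := abs_le.1 (hwf w)
    have := hh0 w
    have := hh1 w
    exact abs_le.2 ⟨by simp only [hf']; linarith, by simp only [hf']; linarith⟩
  have hlip : ∀ x w, |f x - f w| ≤ 2 * |x - w| := fun x w =>
    Convex.norm_image_sub_le_of_norm_hasDerivWithin_le (s := Set.univ)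
      (fun y _ => (hfd y).hasDerivWithinAt) (fun y _ => hf'2 y) convex_univ trivial trivial
  set R : ℝ → ℝ := fun w =>
    δ * K + 2 * δ * |w| + (Set.Icc (z - δ) (z + 2 * δ)).indicator 1 w with hR
  have hhR : ∀ x w, |x - w| ≤ δ →
      |h x - h w| ≤ (Set.Icc (z - δ) (z + 2 * δ)).indicator 1 w := fun x w hxw => by
    have hxw' := abs_le.1 hxw
    by_cases hw : w ∈ Set.Icc (z - δ) (z + 2 * δ)
    · rw [Set.indicator_of_mem hw]
      exact abs_le.2 ⟨by simp only [Pi.one_apply]; linarith [hh0 x, hh1 w],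
        by simp only [Pi.one_apply]; linarith [hh0 w, hh1 x]⟩
    · rw [Set.indicator_of_notMem hw]
      rw [Set.mem_Icc, not_and_or, not_le, not_le] at hw
      rcases hw with hw | hw
      · rw [hhl x (by linarith), hhl w (by linarith)]; simp
      · rw [hhr x (by linarith), hhr w (by linarith)]; simp
  have hRf' : ∀ x w, |x - w| ≤ δ → |f' x - f' w| ≤ R w := fun x w hxw => by
    have e : f' x - f' w = (x - w) * f x + w * (f x - f w) + (h x - h w) := by
      simp only [hf']; ring
    rw [e]
    refine (abs_add_three _ _ _).trans ?_
    rw [abs_mul, abs_mul]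
    have i1 : |x - w| * |f x| ≤ δ * K := mul_le_mul hxw (hfK x) (abs_nonneg _) hδ.le
    have i2 : |w| * |f x - f w| ≤ 2 * δ * |w| := by
      have := hlip x w
      have := abs_nonneg w
      nlinarith
    have i3 := hhR x w hxw
    simp only [hR]
    linarith
  have hR0 : ∀ w, 0 ≤ R w := fun w => (abs_nonneg _).trans (hRf' w w (by simpa using hδ.le))
  have htaylor : ∀ w x, |x| ≤ δ → |f w - f (w - x) - x * f' w| ≤ R w * |x| := fun w x hx => by
    have := Convex.norm_image_sub_le_of_norm_hasDerivWithin_le (𝕜 := ℝ) (s := Metric.closedBall w δ)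
      (f := fun y => f y - y * f' w) (f' := fun y => f' y - f' w) (C := R w)
      (x := w - x) (y := w)
      (fun y _ => ((hfd y).sub (by simpa using (hasDerivAt_id y).mul_const (f' w))).hasDerivWithinAt)
      (fun y hy => hRf' y w (by simpa [Real.dist_eq] using hy)) (convex_closedBall w δ)
      (by simpa [Real.dist_eq] using hx) (by simpa using hδ.le)
    rw [Real.norm_eq_abs, Real.norm_eq_abs] at this
    have e : f w - w * f' w - (f (w - x) - (w - x) * f' w) = f w - f (w - x) - x * f' w := by ring
    rwa [e, sub_sub_cancel] at this
  have hpt : ∀ ω : Fin n → A, f' (∑ i, ξ (ω i))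
      - ∑ j, ξ (ω j) * (f (∑ i, ξ (ω i)) - f (∑ i, ξ (ω i) - ξ (ω j)))
      ≤ 2 * |∑ i, ξ (ω i) ^ 2 - 1| + D * R (∑ i, ξ (ω i)) := fun ω => by
    set W := ∑ i, ξ (ω i) with hW
    set Q := ∑ i, ξ (ω i) ^ 2 with hQ
    have hQD : Q ≤ D := by
      refine le_trans ?_ hD
      calc Q ≤ ∑ _i : Fin n, δ ^ 2 := Finset.sum_le_sum fun i _ => by
            rw [← sq_abs]
            have := H.bound (ω i)
            gcongr
        _ = n * δ ^ 2 := by simp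
    have i1 : Q * f' W - ∑ j, ξ (ω j) * (f W - f (W - ξ (ω j))) ≤ Q * R W := by
      rw [hQ, Finset.sum_mul, Finset.sum_mul, ← Finset.sum_sub_distrib]
      refine Finset.sum_le_sum fun j _ => ?_
      have t := htaylor W (ξ (ω j)) (H.bound _)
      calc ξ (ω j) ^ 2 * f' W - ξ (ω j) * (f W - f (W - ξ (ω j)))
          = -ξ (ω j) * (f W - f (W - ξ (ω j)) - ξ (ω j) * f' W) := by ring
        _ ≤ |-ξ (ω j) * (f W - f (W - ξ (ω j)) - ξ (ω j) * f' W)| := le_abs_self _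
        _ ≤ |ξ (ω j)| * (R W * |ξ (ω j)|) := by
          rw [abs_mul, abs_neg]
          exact mul_le_mul_of_nonneg_left t (abs_nonneg _)
        _ = |ξ (ω j)| ^ 2 * R W := by ring
        _ = ξ (ω j) ^ 2 * R W := by rw [sq_abs]
    have i2 : (1 - Q) * f' W ≤ 2 * |Q - 1| := by
      refine (le_abs_self _).trans ?_
      rw [abs_mul, abs_sub_comm, mul_comm]
      exact mul_le_mul_of_nonneg_right (hf'2 W) (abs_nonneg _)
    have i3 : Q * R W ≤ D * R W := mul_le_mul_of_nonneg_right hQD (hR0 W)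
    linarith
  have hER : iidExp p (fun ω : Fin n → A => R (∑ i, ξ (ω i))) ≤ (K + 6) * δ := by
    simp only [hR]
    rw [iidExp_add, iidExp_add, iidExp_const H.sum_eq_one, iidExp_const_mul]
    have c1 := H.iidExp_mem_Icc_le (a := z - δ) (b := z + 2 * δ) (by linarith)
    have c2 := H.iidExp_abs_sum_le
    nlinarith
  have hD0 : 0 ≤ D := le_trans (by positivity) hD
  have hle := iidExp_mono H.nonneg hpt
  rw [iidExp_sub, ← iidExp_sum_mul H.mean, ← iidExp_sub, iidExp_add, iidExp_const_mul,
    iidExp_const_mul] at hle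
  have hind : iidExp p (fun ω : Fin n → A => (Set.Iic z).indicator 1 (∑ i, ξ (ω i)))
      ≤ iidExp p (fun ω : Fin n → A =>
        (f' (∑ i, ξ (ω i)) - (∑ i, ξ (ω i)) * f (∑ i, ξ (ω i))) + N) := by
    refine iidExp_mono H.nonneg fun ω => ?_
    have e : ∀ w, f' w - w * f w + N = h w := fun w => by simp only [hf']; ring
    rw [e]
    by_cases hw : ∑ i, ξ (ω i) ∈ Set.Iic z
    · rw [Set.indicator_of_mem hw, hhl _ hw]; rfl
    · rw [Set.indicator_of_notMem hw]; exact hh0 _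
  rw [iidExp_add, iidExp_const H.sum_eq_one] at hind
  have hq := H.iidExp_abs_sum_sq_sub_one_le
  have := mul_le_mul_of_nonneg_left hER hD0
  linarith

end IID

section Code

variable {X Y : Type*} [Fintype X] [Fintype Y]

lemma iidExp_prod (P : X → Y → ℝ) {n : ℕ} (g : (Fin n → X × Y) → ℝ) :
    iidExp (fun a : X × Y => P a.1 a.2) g
      = ∑ xs : Fin n → X, ∑ ys : Fin n → Y,
        (∏ i, P (xs i) (ys i)) * g (fun i => (xs i, ys i)) := by
  rw [iidExp, ← (Equiv.arrowProdEquivProdArrow (Fin n) (fun _ => X) (fun _ => Y)).symm.sum_comp,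
    Fintype.sum_prod_type]
  rfl

/-- One-shot converse: the success probability of a code is bounded by the lower tail of the
conditional information density plus a multiple of the number of syndromes. -/
lemma success_le_tail_add {P : X → Y → ℝ} (hP0 : ∀ x y, 0 ≤ P x y) (hP1 : ∑ x, ∑ y, P x y = 1)
    {n : ℕ} {M : Type*} [Fintype M] {e : (Fin n → X) → M → ℝ}
    {d : (Fin n → Y) → M → (Fin n → X) → ℝ}
    (he0 : ∀ xs m, 0 ≤ e xs m) (he1 : ∀ xs, ∑ m, e xs m = 1)
    (hd0 : ∀ ys m xs, 0 ≤ d ys m xs) (hd1 : ∀ ys m, ∑ xs, d ys m xs = 1) (γ : ℝ) :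
    ∑ xs : Fin n → X, ∑ ys : Fin n → Y, ∑ m : M, (∏ i, P (xs i) (ys i)) * e xs m * d ys m xs
      ≤ iidExp (fun a : X × Y => P a.1 a.2) (fun ω : Fin n → X × Y =>
          (Set.Iic γ).indicator 1 (∑ i, Real.log ((∑ x', P x' (ω i).2) / P (ω i).1 (ω i).2)))
        + Fintype.card M * Real.exp (-γ) := by
  have hQ0 : ∀ y, 0 ≤ ∑ x', P x' y := fun y => Finset.sum_nonneg fun x _ => hP0 x y
  have hsingle : ∀ x y, P x y ≤ (∑ x', P x' y) * Real.exp (-Real.log ((∑ x', P x' y) / P x y)) := by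
    intro x y
    rcases (hP0 x y).eq_or_lt with h | h
    · rw [← h]
      exact mul_nonneg (hQ0 y) (Real.exp_pos _).le
    · have hQ : 0 < ∑ x', P x' y :=
        h.trans_le (Finset.single_le_sum (fun x _ => hP0 x y) (Finset.mem_univ x))
      rw [← Real.log_inv, Real.exp_log (by positivity)]
      field_simp
      exact le_rfl
  have he1' : ∀ xs m, e xs m ≤ 1 := fun xs m => by
    rw [← he1 xs]; exact Finset.single_le_sum (fun m _ => he0 xs m) (Finset.mem_univ m)
  have hd1' : ∀ ys m xs, d ys m xs ≤ 1 := fun ys m xs => by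
    rw [← hd1 ys m]; exact Finset.single_le_sum (fun x _ => hd0 ys m x) (Finset.mem_univ xs)
  have hterm : ∀ (xs : Fin n → X) (ys : Fin n → Y),
      ∑ m : M, (∏ i, P (xs i) (ys i)) * e xs m * d ys m xs
      ≤ (∏ i, P (xs i) (ys i)) * (Set.Iic γ).indicator 1
            (∑ i, Real.log ((∑ x', P x' (ys i)) / P (xs i) (ys i)))
        + ((∏ i, ∑ x', P x' (ys i)) * Real.exp (-γ)) * ∑ m, d ys m xs := by
    intro xs ys
    have hw0 : 0 ≤ ∏ i, P (xs i) (ys i) := Finset.prod_nonneg fun i _ => hP0 _ _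
    have hq0 : 0 ≤ ∏ i, ∑ x', P x' (ys i) := Finset.prod_nonneg fun i _ => hQ0 _
    by_cases hL : ∑ i, Real.log ((∑ x', P x' (ys i)) / P (xs i) (ys i)) ∈ Set.Iic γ
    · rw [Set.indicator_of_mem hL]
      refine le_add_of_le_of_nonneg ?_
        (mul_nonneg (mul_nonneg hq0 (Real.exp_pos _).le)
          (Finset.sum_nonneg fun m _ => hd0 ys m xs))
      simp only [mul_assoc]
      rw [← Finset.mul_sum]
      refine mul_le_mul_of_nonneg_left ?_ hw0
      rw [Pi.one_apply, ← he1 xs]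
      exact Finset.sum_le_sum fun m _ => mul_le_of_le_one_right (he0 xs m) (hd1' ys m xs)
    · rw [Set.indicator_of_notMem hL, mul_zero, zero_add, Finset.mul_sum]
      refine Finset.sum_le_sum fun m _ => ?_
      refine mul_le_mul_of_nonneg_right ?_ (hd0 ys m xs)
      refine (mul_le_of_le_one_right hw0 (he1' xs m)).trans ?_
      calc ∏ i, P (xs i) (ys i) ≤ ∏ i, ((∑ x', P x' (ys i)) *
            Real.exp (-Real.log ((∑ x', P x' (ys i)) / P (xs i) (ys i)))) :=
          Finset.prod_le_prod (fun i _ => hP0 _ _) fun i _ => hsingle _ _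
        _ = (∏ i, ∑ x', P x' (ys i)) *
            Real.exp (-∑ i, Real.log ((∑ x', P x' (ys i)) / P (xs i) (ys i))) := by
          rw [Finset.prod_mul_distrib, ← Real.exp_sum, Finset.sum_neg_distrib]
        _ ≤ (∏ i, ∑ x', P x' (ys i)) * Real.exp (-γ) := by
          rw [Set.mem_Iic, not_le] at hL
          gcongr
  refine (Finset.sum_le_sum fun xs _ => Finset.sum_le_sum fun ys _ => hterm xs ys).trans_eq ?_
  rw [iidExp_prod]
  simp only [Finset.sum_add_distrib]
  congr 1
  rw [Finset.sum_comm]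
  have hinner : ∀ ys : Fin n → Y, ∑ xs, ((∏ i, ∑ x', P x' (ys i)) * Real.exp (-γ)) * ∑ m, d ys m xs
      = (∏ i, ∑ x', P x' (ys i)) * (Fintype.card M * Real.exp (-γ)) := fun ys => by
    rw [← Finset.mul_sum, Finset.sum_comm, Finset.sum_congr rfl fun m _ => hd1 ys m]
    simp
    ring
  rw [Finset.sum_congr rfl fun ys _ => hinner ys, ← Finset.sum_mul,
    ← Fintype.sum_pow (fun y => ∑ x', P x' y), Finset.sum_comm, hP1, one_pow, one_mul]

/-- The centred and scaled conditional information density is standardised. -/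
lemma isStandardised_infoDensity {P : X → Y → ℝ} (hP0 : ∀ x y, 0 ≤ P x y)
    (hP1 : ∑ x, ∑ y, P x y = 1) (hV : 0 < condV P) {B : ℝ} (hB : 0 < B)
    (hbound : ∀ x y, |Real.log ((∑ x', P x' y) / P x y) - condH P| ≤ B) {n : ℕ} (hn : 0 < n) :
    IsStandardised (fun a : X × Y => P a.1 a.2)
      (fun a => (Real.log ((∑ x', P x' a.2) / P a.1 a.2) - condH P) / Real.sqrt (n * condV P))
      n (B / Real.sqrt (n * condV P)) := by
  have hn' : (0 : ℝ) < n := by exact_mod_cast hn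
  have hs : 0 < Real.sqrt (n * condV P) := Real.sqrt_pos.2 (by positivity)
  refine ⟨fun a => hP0 _ _, ?_, ?_, ?_, by positivity, fun a => ?_⟩
  · rw [Fintype.sum_prod_type]; exact hP1
  · rw [Fintype.sum_prod_type]
    simp only [← mul_div_assoc, ← Finset.sum_div, mul_sub, Finset.sum_sub_distrib,
      ← Finset.sum_mul, hP1]
    simp [condH]
  · rw [Fintype.sum_prod_type]
    simp only [div_pow, ← mul_div_assoc, ← Finset.sum_div]
    rw [Real.sq_sqrt (by positivity)]
    exact div_self (by positivity : (n : ℝ) * condV P ≠ 0)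
  · rw [abs_div, abs_of_pos hs]
    gcongr
    exact hbound _ _

end Code

end SecondOrder

/-- second-order converse for information reconciliation: if
`V(X|Y)_P > 0` and `0 < ε < 1`, there is a constant `C` such that for all
sufficiently large `n`, any ε-correct one-way IR code on `(P_{XY})^{×n}`
satisfies `log|M| ≥ n H + √(n V) Φ⁻¹(1-ε) - (1/2) log n - C`. -/
theorem second_order_converse_IR {X Y : Type*} [Fintype X] [Fintype Y]
    (ε : ℝ) (hε0 : 0 < ε) (hε1 : ε < 1)
    (P : X → Y → ℝ) (hP0 : ∀ x y, 0 ≤ P x y) (hP1 : ∑ x, ∑ y, P x y = 1)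
    (hV : 0 < condV P) :
    ∃ C : ℝ, ∃ N : ℕ, ∀ n ≥ N, ∀ (M : Type) (_ : Fintype M)
      (e : (Fin n → X) → M → ℝ) (d : (Fin n → Y) → M → (Fin n → X) → ℝ),
      (∀ xs m, 0 ≤ e xs m) → (∀ xs, ∑ m, e xs m = 1) →
      (∀ ys m xs, 0 ≤ d ys m xs) → (∀ ys m, ∑ xs, d ys m xs = 1) →
      (1 - ε ≤ ∑ xs : Fin n → X, ∑ ys : Fin n → Y, ∑ m : M,
        (∏ i, P (xs i) (ys i)) * e xs m * d ys m xs) →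
      n * condH P + Real.sqrt (n * condV P) * NPhiInv (1 - ε)
        - (1/2) * Real.log n - C ≤ Real.log (Fintype.card M) := by
  
  set T := NPhiInv (1 - ε) with hT
  have hPhiT : NPhi T = 1 - ε := NPhi_NPhiInv (by linarith) (by linarith)
  obtain ⟨c, hc, hPhi⟩ := NPhi_sub_le T
  obtain ⟨K, hK, hBE⟩ := exists_berry_esseen (A := X × Y)
  set V := condV P with hVdef
  obtain ⟨B, hB, hbound⟩ : ∃ B > 0, ∀ x y,
      |Real.log ((∑ x', P x' y) / P x y) - condH P| ≤ B := by
    obtain ⟨B, hB⟩ := (Set.finite_range fun a : X × Y =>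
      |Real.log ((∑ x', P x' a.2) / P a.1 a.2) - condH P|).bddAbove
    exact ⟨max B 1, by positivity, fun x y => (hB ⟨(x, y), rfl⟩).trans (le_max_left _ _)⟩
  set K' := B ^ 2 / V * K + 2 with hK'
  set E := (K' * B + Real.sqrt V + 1) / c with hE
  have hE0 : 0 < E := by positivity
  refine ⟨B + E, ⌈E ^ 2 / V⌉₊ + 1, fun n hn M _ e d he0 he1 hd0 hd1 hsucc => ?_⟩
  have hn0 : 0 < n := by omega
  have hn' : (0 : ℝ) < n := by exact_mod_cast hn0
  set s := Real.sqrt (n * V) with hs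
  have hs0 : 0 < s := Real.sqrt_pos.2 (by positivity)
  have hs2 : s ^ 2 = n * V := Real.sq_sqrt (by positivity)
  have hsE : E ≤ s := by
    refine Real.le_sqrt_of_sq_le ?_
    have h1 : E ^ 2 / V ≤ n := (Nat.le_ceil _).trans (by exact_mod_cast (by omega))
    rwa [div_le_iff₀ hV] at h1
  by_contra! hlt
  set γ := n * condH P + s * T - (B + E) with hγ
  have hcard : Fintype.card M * Real.exp (-γ) ≤ 1 / Real.sqrt n := by
    have h1 : (Fintype.card M : ℝ) ≤ Real.exp (γ - 1 / 2 * Real.log n) :=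
      (Real.le_exp_log _).trans (Real.exp_le_exp.2 (by simp only [hγ]; linarith))
    calc Fintype.card M * Real.exp (-γ)
        ≤ Real.exp (γ - 1 / 2 * Real.log n) * Real.exp (-γ) := by gcongr
      _ = Real.exp (-(1 / 2 * Real.log n)) := by rw [← Real.exp_add]; ring_nf
      _ = 1 / Real.sqrt n := by
        rw [Real.exp_neg, mul_comm, Real.exp_mul, Real.exp_log hn', ← Real.sqrt_eq_rpow,
          one_div]
  have hstd := isStandardised_infoDensity hP0 hP1 hV hB hbound hn0
  have htail := hBE _ _ n _ (B ^ 2 / V) hstd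
    (by rw [← hVdef, ← hs, div_pow, hs2]; field_simp; exact le_rfl) (T - (B + E) / s)
  rw [← hVdef, ← hs] at htail
  have hind : ∀ ω : Fin n → X × Y,
      (Set.Iic γ).indicator (1 : ℝ → ℝ)
        (∑ i, Real.log ((∑ x', P x' (ω i).2) / P (ω i).1 (ω i).2))
      = (Set.Iic (T - (B + E) / s)).indicator 1
        (∑ i, (Real.log ((∑ x', P x' (ω i).2) / P (ω i).1 (ω i).2) - condH P) / s) := fun ω => by
    have hiff : ∑ i, (Real.log ((∑ x', P x' (ω i).2) / P (ω i).1 (ω i).2) - condH P) / s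
          ≤ T - (B + E) / s
        ↔ ∑ i, Real.log ((∑ x', P x' (ω i).2) / P (ω i).1 (ω i).2) ≤ γ := by
      have : T - (B + E) / s = (s * T - (B + E)) / s := by field_simp
      rw [← Finset.sum_div, Finset.sum_sub_distrib, this, div_le_div_iff_of_pos_right hs0]
      simp only [Finset.sum_const, Finset.card_univ, Fintype.card_fin, nsmul_eq_mul, hγ]
      constructor <;> intro h <;> linarith
    simp only [Set.indicator, Set.mem_Iic, hiff, Pi.one_apply]
  have hone := success_le_tail_add hP0 hP1 he0 he1 hd0 hd1 γ
  rw [show (fun ω : Fin n → X × Y => (Set.Iic γ).indicator (1 : ℝ → ℝ)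
    (∑ i, Real.log ((∑ x', P x' (ω i).2) / P (ω i).1 (ω i).2))) = _ from funext hind] at hone
  have harg : T - (B + E) / s + B / s = T - E / s := by ring
  rw [harg] at htail
  have hgap := hPhi (E / s) (by positivity) ((div_le_one hs0).2 hsE)
  have hsn : 1 / Real.sqrt n = Real.sqrt V / s := by
    have : 0 < Real.sqrt n := Real.sqrt_pos.2 hn'
    rw [hs, Real.sqrt_mul hn'.le, div_mul_cancel_right₀ (Real.sqrt_pos.2 hV).ne', one_div]
  have hfinal : c * (E / s) = K' * (B / s) + Real.sqrt V / s + 1 / s := by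
    simp only [hE]
    field_simp
  have : 0 < 1 / s := by positivity
  linarith
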